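/- Monotonicity of the limit scheme under the CFL condition: let r ≥ 0, Δt > 0, Δx > 0, Δv > 0, v_1,…,v_{N_v} ∈ ℝ, M_1,…,M_{N_v} > 0, v_max = max_j |v_j|, and let h : ℝ² → ℝ be a function such that for all (p,q), 1 + r + h(p,q) − max(v_j,0)·p − min(v_j,0)·q > 0 for every j and Δv·Σ_j M_j/(1 + r + h(p,q) − max(v_j,0)·p − min(v_j,0)·q) = 1/(1+r). If v_max·Δt/Δx ≤ 1, then the map F(a,b,c) := b − Δt·h((b − a)/Δx, (c − b)/Δx) is nondecreasing in each of its three arguments a, b, c. -/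

import Mathlib

/-- If two families of positive denominators give the same positively weighted sum of reciprocals,
then the first family cannot exceed the second one everywhere. -/
theorem exists_le_of_sum_div_eq {ι : Type*} [Fintype ι] [Nonempty ι] {M x y : ι → ℝ}
    (hM : ∀ j, 0 < M j) (hy : ∀ j, 0 < y j) (hxy : ∑ j, M j / x j = ∑ j, M j / y j) :
    ∃ j, x j ≤ y j := by
  by_contra! hlt
  exact (Finset.sum_lt_sum_of_nonempty Finset.univ_nonempty fun j _ =>
    div_lt_div_of_pos_left (hM j) (hy j) (hlt j)).ne hxy

/-- Monotonicity of the limit scheme under the CFL condition. -/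
theorem limit_scheme_monotone
    (r Δt Δx Δv : ℝ) (Nv : ℕ)
    (hr : 0 ≤ r) (hΔt : 0 < Δt) (hΔx : 0 < Δx) (hΔv : 0 < Δv) (hNv : 1 ≤ Nv)
    (v M : Fin Nv → ℝ) (hM : ∀ j, 0 < M j)
    (vmax : ℝ)
    (hvmax : vmax = Finset.univ.sup'
      (Finset.univ_nonempty_iff.mpr (Fin.pos_iff_nonempty.mp (by omega)))
      (fun j => |v j|))
    (h : ℝ → ℝ → ℝ)
    (hden : ∀ p q j, 0 < 1 + r + h p q - max (v j) 0 * p - min (v j) 0 * q)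
    (heq : ∀ p q,
      Δv * ∑ j, M j / (1 + r + h p q - max (v j) 0 * p - min (v j) 0 * q)
        = 1 / (1 + r))
    (hCFL : vmax * Δt / Δx ≤ 1) :
    (∀ b c, Monotone (fun a => b - Δt * h ((b - a) / Δx) ((c - b) / Δx))) ∧
    (∀ a c, Monotone (fun b => b - Δt * h ((b - a) / Δx) ((c - b) / Δx))) ∧
    (∀ a b, Monotone (fun c => b - Δt * h ((b - a) / Δx) ((c - b) / Δx))) := by
  have : Nonempty (Fin Nv) := Fin.pos_iff_nonempty.mp (by omega)
  have key : ∀ p q p' q', ∃ j,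
      h p' q' - h p q ≤ max (v j) 0 * (p' - p) + min (v j) 0 * (q' - q) := by
    intro p q p' q'
    obtain ⟨j, hj⟩ := exists_le_of_sum_div_eq hM (hden p q)
      (mul_left_cancel₀ hΔv.ne' ((heq p' q').trans (heq p q).symm))
    exact ⟨j, by linarith⟩
  refine ⟨fun b c a a' haa' => ?_, fun a c b b' hbb' => ?_, fun a b c c' hcc' => ?_⟩
  · obtain ⟨j, hj⟩ := key ((b - a) / Δx) ((c - b) / Δx) ((b - a') / Δx) ((c - b) / Δx)
    have hp : (b - a') / Δx ≤ (b - a) / Δx := by gcongr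
    have hle : h ((b - a') / Δx) ((c - b) / Δx) ≤ h ((b - a) / Δx) ((c - b) / Δx) := by
      have := mul_nonneg (le_max_right (v j) 0) (sub_nonneg.mpr hp)
      linarith
    exact sub_le_sub_left (mul_le_mul_of_nonneg_left hle hΔt.le) b
  · obtain ⟨j, hj⟩ := key ((b - a) / Δx) ((c - b) / Δx) ((b' - a) / Δx) ((c - b') / Δx)
    have habs : max (v j) 0 - min (v j) 0 = |v j| := by
      rw [max_sub_min_eq_abs', sub_zero]
    have hv : |v j| ≤ vmax := hvmax ▸ Finset.le_sup' (fun j => |v j|) (Finset.mem_univ j)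
    have hcfl : |v j| * Δt / Δx ≤ 1 := le_trans (by gcongr) hCFL
    have hbound : max (v j) 0 * ((b' - a) / Δx - (b - a) / Δx)
        + min (v j) 0 * ((c - b') / Δx - (c - b) / Δx) = |v j| * (b' - b) / Δx := by
      rw [← habs]; ring
    have hstep : Δt * (|v j| * (b' - b) / Δx) ≤ b' - b :=
      calc Δt * (|v j| * (b' - b) / Δx) = |v j| * Δt / Δx * (b' - b) := by ring
        _ ≤ b' - b := mul_le_of_le_one_left (sub_nonneg.mpr hbb') hcfl
    rw [hbound] at hj
    have := mul_le_mul_of_nonneg_left hj hΔt.le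
    dsimp only
    linarith
  · obtain ⟨j, hj⟩ := key ((b - a) / Δx) ((c - b) / Δx) ((b - a) / Δx) ((c' - b) / Δx)
    have hq : (c - b) / Δx ≤ (c' - b) / Δx := by gcongr
    have hle : h ((b - a) / Δx) ((c' - b) / Δx) ≤ h ((b - a) / Δx) ((c - b) / Δx) := by
      have := mul_nonpos_of_nonpos_of_nonneg (min_le_right (v j) 0) (sub_nonneg.mpr hq)
      linarith
    exact sub_le_sub_left (mul_le_mul_of_nonneg_left hle hΔt.le) b
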